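/- arXiv:1112.2434 — 2 statements merged into one kernel-verified Lean document; each statement's English description precedes it below -/
import Mathlib

section
/- If G is of type A₁ or Cₙ, then the quotient X_*(T)/ℤΦ_K^∨ is isomorphic to ℤ, where K is the fixed subgroup of the split Cartan involution ρ^∨(−1) (so K ≅ GLₙ has fundamental group ℤ). -/
/-! STATEMENT 2: If `G` is of type A₁ or Cₙ then the quotient of the coweight lattice
`X_*(T) = ℤΦ^∨` by the coroot lattice of `K = G^{ρ^∨(−1)}` (whose roots are the roots
`β` of `G` with `⟨ρ^∨, β⟩` even) is isomorphic to `ℤ`. -/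

open scoped RealInnerProductSpace


variable {V : Type*} [NormedAddCommGroup V] [InnerProductSpace ℝ V]

/-- A finite subset of a Euclidean space is a (reduced, crystallographic) root system. -/
def IsRootSystem (Φ : Finset V) : Prop :=
  (0 : V) ∉ Φ ∧
  Submodule.span ℝ (Φ : Set V) = ⊤ ∧
  (∀ α ∈ Φ, ∀ β ∈ Φ, β - (2 * ⟪β, α⟫ / ⟪α, α⟫) • α ∈ Φ) ∧
  (∀ α ∈ Φ, ∀ β ∈ Φ, ∃ n : ℤ, 2 * ⟪β, α⟫ / ⟪α, α⟫ = (n : ℝ)) ∧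
  (∀ α ∈ Φ, ∀ t : ℝ, t • α ∈ Φ → t = 1 ∨ t = -1)

/-- Irreducibility: the root system admits no decomposition into two nonempty mutually
orthogonal parts. -/
def IsIrreducibleRS (Φ : Finset V) : Prop :=
  Φ.Nonempty ∧ ∀ S T : Set V, S ∪ T = (Φ : Set V) → S.Nonempty → T.Nonempty →
    (∀ a ∈ S, ∀ b ∈ T, ⟪a, b⟫ = 0) → False

/-- A base (set of simple roots) of a root system. -/
def IsBase (Φ Δ : Finset V) : Prop :=
  Δ ⊆ Φ ∧ LinearIndependent ℝ (fun x : {x // x ∈ Δ} => (x : V)) ∧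
  ∀ β ∈ Φ, ∃ c : V → ℤ,
    β = ∑ α ∈ Δ, (c α : ℝ) • α ∧ ((∀ α ∈ Δ, 0 ≤ c α) ∨ (∀ α ∈ Δ, c α ≤ 0))

/-- The Weyl group: the subgroup of linear automorphisms generated by the reflections in
the roots. -/
def weylGroup (Φ : Finset V) : Subgroup (V ≃ₗ[ℝ] V) :=
  Subgroup.closure {w | ∃ α ∈ Φ, ∀ v, w v = v - (2 * ⟪v, α⟫ / ⟪α, α⟫) • α}

/-- The positive roots relative to a base. -/
def positiveRoots (Φ Δ : Finset V) : Set V :=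
  {β | β ∈ Φ ∧ ∃ c : V → ℤ, β = ∑ α ∈ Δ, (c α : ℝ) • α ∧ ∀ α ∈ Δ, 0 ≤ c α}

/-- Cartan matrix of type Aₙ. -/
def cartanA (n : ℕ) : Matrix (Fin n) (Fin n) ℤ := fun i j =>
  if i = j then 2 else if (i : ℕ) + 1 = j ∨ (j : ℕ) + 1 = i then -1 else 0

/-- Cartan matrix of type Bₙ. -/
def cartanB (n : ℕ) : Matrix (Fin n) (Fin n) ℤ := fun i j =>
  if i = j then 2
  else if (i : ℕ) + 1 = j then (if (j : ℕ) + 1 = n then -2 else -1)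
  else if (j : ℕ) + 1 = i then -1 else 0

/-- Cartan matrix of type Cₙ (the transpose of type Bₙ). -/
def cartanC (n : ℕ) : Matrix (Fin n) (Fin n) ℤ := (cartanB n).transpose

/-- Cartan matrix of type Dₙ. -/
def cartanD (n : ℕ) : Matrix (Fin n) (Fin n) ℤ := fun i j =>
  if i = j then 2
  else if ((i : ℕ) + 1 = j ∧ (j : ℕ) + 2 ≤ n) ∨ ((j : ℕ) + 1 = i ∧ (i : ℕ) + 2 ≤ n) ∨
      ((i : ℕ) + 3 = n ∧ (j : ℕ) + 1 = n) ∨ ((j : ℕ) + 3 = n ∧ (i : ℕ) + 1 = n) then -1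
  else 0

/-- The set of simple roots `Δ` has Cartan matrix `M` (up to reindexing); this is how we
say that the root system is "of type `M`". -/
def MatchesCartan (Δ : Finset V) {n : ℕ} (M : Matrix (Fin n) (Fin n) ℤ) : Prop :=
  ∃ e : {x // x ∈ Δ} ≃ Fin n,
    ∀ i j : {x // x ∈ Δ},
      2 * ⟪(i : V), (j : V)⟫ / ⟪(j : V), (j : V)⟫ = (M (e i) (e j) : ℝ)


/-- The coroot associated to a root. -/
noncomputable def coroot (α : V) : V := (2 / ⟪α, α⟫) • α

/-- The reflection of `β` in the hyperplane orthogonal to `α`. -/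
noncomputable def rootReflection (α β : V) : V := β - (2 * ⟪β, α⟫ / ⟪α, α⟫) • α

lemma IsRootSystem.ne_zero {Φ : Finset V} (hΦ : IsRootSystem Φ) {α : V} (hα : α ∈ Φ) : α ≠ 0 :=
  fun h => hΦ.1 (h ▸ hα)

lemma IsRootSystem.rootReflection_mem {Φ : Finset V} (hΦ : IsRootSystem Φ) {α β : V}
    (hα : α ∈ Φ) (hβ : β ∈ Φ) : rootReflection α β ∈ Φ :=
  hΦ.2.2.1 α hα β hβ

lemma IsRootSystem.neg_mem {Φ : Finset V} (hΦ : IsRootSystem Φ) {β : V} (hβ : β ∈ Φ) :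
    -β ∈ Φ := by
  have h0 : ⟪β, β⟫ ≠ 0 := inner_self_ne_zero.mpr (hΦ.ne_zero hβ)
  have h := hΦ.rootReflection_mem hβ hβ
  rw [rootReflection, mul_div_assoc, div_self h0, mul_one, two_smul] at h
  simpa using h

/-- Coordinates with respect to a base are unique. -/
lemma IsBase.coeff_unique {Φ Δ : Finset V} (hΔ : IsBase Φ Δ) {c d : V → ℤ}
    (h : ∑ α ∈ Δ, (c α : ℝ) • α = ∑ α ∈ Δ, (d α : ℝ) • α) : ∀ α ∈ Δ, c α = d α := by
  intro α hα
  have hli := hΔ.2.1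
  rw [Fintype.linearIndependent_iff] at hli
  have h0 : ∑ x : {x // x ∈ Δ}, ((c x : ℝ) - d x) • (x : V) = 0 := by
    rw [Finset.sum_coe_sort Δ (fun x => ((c x : ℝ) - d x) • x)]
    simp only [sub_smul, Finset.sum_sub_distrib, h, sub_self]
  have := hli (fun x => (c x : ℝ) - d x) h0 ⟨α, hα⟩
  exact_mod_cast sub_eq_zero.mp this

lemma sum_update_sub_smul {Δ : Finset V} [DecidableEq V] {α : V} (hα : α ∈ Δ) (c : V → ℤ) (m : ℤ) :
    ∑ γ ∈ Δ, ((Function.update c α (c α - m) γ : ℤ) : ℝ) • γ =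
      ∑ γ ∈ Δ, (c γ : ℝ) • γ - (m : ℝ) • α := by
  rw [← Finset.add_sum_erase _ _ hα, ← Finset.add_sum_erase _ (fun γ => (c γ : ℝ) • γ) hα]
  have : ∑ γ ∈ Δ.erase α, ((Function.update c α (c α - m) γ : ℤ) : ℝ) • γ =
      ∑ γ ∈ Δ.erase α, (c γ : ℝ) • γ :=
    Finset.sum_congr rfl fun γ hγ => by rw [Function.update_of_ne (Finset.ne_of_mem_erase hγ)]
  rw [this, Function.update_self]
  push_cast
  module

/-- A simple reflection keeps every positive root other than the simple root itself positive. -/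
lemma IsBase.update_nonneg {Φ Δ : Finset V} [DecidableEq V] (hΦ : IsRootSystem Φ)
    (hΔ : IsBase Φ Δ) {α β : V} (hα : α ∈ Δ) (hβ : β ∈ Φ) (hne : β ≠ α) {c : V → ℤ}
    (hc : β = ∑ γ ∈ Δ, (c γ : ℝ) • γ) (hc0 : ∀ γ ∈ Δ, 0 ≤ c γ) {m : ℤ}
    (hm : β - (m : ℝ) • α ∈ Φ) : ∀ γ ∈ Δ, 0 ≤ Function.update c α (c α - m) γ := by
  obtain ⟨d, hd, hd0⟩ := hΔ.2.2 _ hm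
  have hcd := hΔ.coeff_unique (c := Function.update c α (c α - m)) (d := d) (by
    rw [sum_update_sub_smul hα, ← hc, hd])
  obtain ⟨γ, hγ, hγα, hγ0⟩ : ∃ γ ∈ Δ, γ ≠ α ∧ 0 < c γ := by
    by_contra! hcon
    have h1 : β = (c α : ℝ) • α := by
      rw [hc, ← Finset.add_sum_erase _ _ hα, Finset.sum_eq_zero, add_zero]
      intro γ hγ
      have h2 := Finset.mem_of_mem_erase hγ
      rw [le_antisymm (hcon γ h2 (Finset.ne_of_mem_erase hγ)) (hc0 γ h2)]
      simp
    rcases hΦ.2.2.2.2 α (hΔ.1 hα) _ (h1 ▸ hβ) with h | h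
    · exact hne (by rw [h1, h, one_smul])
    · have h3 := hc0 α hα
      have h4 : c α = -1 := by exact_mod_cast h
      omega
  rcases hd0 with h | h
  · intro δ hδ
    rw [hcd δ hδ]
    exact h δ hδ
  · have h1 := hcd γ hγ
    rw [Function.update_of_ne hγα] at h1
    have h2 := h γ hγ
    omega

/-- Induction on positive roots along simple reflections. -/
lemma IsBase.positive_induction {Φ Δ : Finset V} (hΦ : IsRootSystem Φ) (hΔ : IsBase Φ Δ)
    {P : V → Prop} (simple : ∀ α ∈ Δ, P α)
    (reflection : ∀ α ∈ Δ, ∀ β, P (rootReflection α β) → P β)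
    {β : V} (hβ : β ∈ Φ) {c : V → ℤ} (hc : β = ∑ γ ∈ Δ, (c γ : ℝ) • γ)
    (hc0 : ∀ γ ∈ Δ, 0 ≤ c γ) : P β := by
  classical
  induction hN : (∑ γ ∈ Δ, c γ).toNat using Nat.strong_induction_on generalizing β c with
  | _ N ih =>
  obtain ⟨α, hα, hpos⟩ : ∃ α ∈ Δ, 0 < ⟪β, α⟫ := by
    by_contra! hcon
    have h1 : ⟪β, β⟫ ≤ 0 := by
      nth_rewrite 2 [hc]
      rw [inner_sum]
      refine Finset.sum_nonpos fun γ hγ => ?_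
      rw [inner_smul_right]
      exact mul_nonpos_of_nonneg_of_nonpos (by exact_mod_cast hc0 γ hγ) (hcon γ hγ)
    exact hΦ.ne_zero hβ (real_inner_self_nonpos.mp h1)
  by_cases hne : β = α
  · exact hne ▸ simple α hα
  obtain ⟨m, hm⟩ := hΦ.2.2.2.1 α (hΔ.1 hα) β hβ
  have hmem := hΦ.rootReflection_mem (hΔ.1 hα) hβ
  have hm0 : 0 < m := by
    have h2 : (0 : ℝ) < m := by
      rw [← hm]
      have := real_inner_self_pos.mpr (hΦ.ne_zero (hΔ.1 hα))
      positivity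
    exact_mod_cast h2
  refine reflection α hα β ?_
  rw [rootReflection, hm] at hmem ⊢
  have hnn := hΔ.update_nonneg hΦ hα hβ hne hc hc0 hmem
  refine ih _ ?_ hmem (c := Function.update c α (c α - m)) ?_ hnn rfl
  · have h3 : ∑ γ ∈ Δ, Function.update c α (c α - m) γ = ∑ γ ∈ Δ, c γ - m := by
      rw [Finset.sum_update_of_mem hα, ← Finset.add_sum_erase _ _ hα, Finset.sdiff_singleton_eq_erase]
      ring
    have h4 := Finset.sum_nonneg hnn
    rw [h3] at h4 ⊢
    omega
  · rw [sum_update_sub_smul hα, ← hc]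

/-- Induction on all roots along simple reflections and negation. -/
lemma IsBase.root_induction {Φ Δ : Finset V} (hΦ : IsRootSystem Φ) (hΔ : IsBase Φ Δ)
    {P : V → Prop} (simple : ∀ α ∈ Δ, P α)
    (reflection : ∀ α ∈ Δ, ∀ β, P (rootReflection α β) → P β) (neg : ∀ β, P (-β) → P β)
    {β : V} (hβ : β ∈ Φ) : P β := by
  obtain ⟨c, hc, hc0 | hc0⟩ := hΔ.2.2 β hβ
  · exact hΔ.positive_induction hΦ simple reflection hβ hc hc0
  · refine neg β (hΔ.positive_induction hΦ simple reflection (hΦ.neg_mem hβ)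
      (c := fun γ => -c γ) ?_ fun γ hγ => by simpa using hc0 γ hγ)
    rw [hc]
    simp

lemma inner_rootReflection_self (α β : V) (hα : α ≠ 0) :
    ⟪α, rootReflection α β⟫ = -⟪α, β⟫ := by
  have h0 : ⟪α, α⟫ ≠ 0 := inner_self_ne_zero.mpr hα
  rw [rootReflection, inner_sub_right, inner_smul_right, real_inner_comm α β]
  field_simp
  ring

lemma norm_rootReflection (α β : V) (hα : α ≠ 0) :
    ⟪rootReflection α β, rootReflection α β⟫ = ⟪β, β⟫ := by
  have h0 : ⟪α, α⟫ ≠ 0 := inner_self_ne_zero.mpr hα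
  simp only [rootReflection, inner_sub_right, inner_sub_left, inner_smul_right, inner_smul_left,
    real_inner_comm α β, conj_trivial]
  field_simp
  ring

lemma rootReflection_rootReflection (α β : V) (hα : α ≠ 0) :
    rootReflection α (rootReflection α β) = β := by
  have h := inner_rootReflection_self α β hα
  rw [real_inner_comm, real_inner_comm β α] at h
  conv_lhs => rw [rootReflection, h]
  rw [rootReflection]
  module

/-- The half sum of the positive coroots pairs to `1` with every simple root. -/
lemma IsBase.inner_half_sum_eq_one {Φ Δ : Finset V} (hΦ : IsRootSystem Φ) (hΔ : IsBase Φ Δ)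
    {ρv : V} {Φpos : Finset V} (hpos : ∀ β, β ∈ Φpos ↔ β ∈ positiveRoots Φ Δ)
    (hρ : (2 : ℝ) • ρv = ∑ β ∈ Φpos, coroot β) {α : V} (hα : α ∈ Δ) : ⟪α, ρv⟫ = 1 := by
  classical
  have hα0 := hΦ.ne_zero (hΔ.1 hα)
  have hαpos : α ∈ Φpos := by
    rw [hpos]
    refine ⟨hΔ.1 hα, fun γ => if γ = α then 1 else 0, ?_, fun γ _ => by positivity⟩
    simp [ite_smul, hα]
  have hsum : ∑ β ∈ Φpos.erase α, ⟪α, coroot β⟫ = 0 := by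
    have hneg : ∀ β, ⟪α, coroot (rootReflection α β)⟫ = -⟪α, coroot β⟫ := fun β => by
      simp only [coroot, inner_smul_right, norm_rootReflection α β hα0,
        inner_rootReflection_self α β hα0, mul_neg]
    refine Finset.sum_involution (fun β _ => rootReflection α β) ?_ ?_ ?_ ?_
    · intro β _
      rw [hneg, add_neg_cancel]
    · intro β _ h0 heq
      have := hneg β
      rw [heq] at this
      exact h0 (by linarith)
    · intro β hβ
      obtain ⟨hβα, hβ⟩ := Finset.mem_erase.mp hβ
      obtain ⟨hβΦ, c, hc, hc0⟩ := (hpos β).mp hβ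
      have hmem := hΦ.rootReflection_mem (hΔ.1 hα) hβΦ
      obtain ⟨m, hm⟩ := hΦ.2.2.2.1 α (hΔ.1 hα) β hβΦ
      have hr : rootReflection α β = β - (m : ℝ) • α := by rw [rootReflection, hm]
      have hnn := hΔ.update_nonneg hΦ hα hβΦ hβα hc hc0 (hr ▸ hmem)
      refine Finset.mem_erase.mpr ⟨fun h => ?_, (hpos _).mpr ⟨hmem, _, ?_, hnn⟩⟩
      · have h1 : β = -α := by
          rw [← rootReflection_rootReflection α β hα0, h, rootReflection, mul_div_assoc,
            div_self (inner_self_ne_zero.mpr hα0)]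
          module
        have h2 := hΔ.coeff_unique (c := c) (d := fun γ => if γ = α then -1 else 0) (by
          rw [← hc, h1]
          simp [ite_smul, hα]) α hα
        have h3 := hc0 α hα
        simp only [if_true] at h2
        omega
      · rw [sum_update_sub_smul hα, ← hc, hr]
    · intro β _
      exact rootReflection_rootReflection α β hα0
  have h1 : 2 * ⟪α, ρv⟫ = 2 := by
    rw [← inner_smul_right, hρ, inner_sum, ← Finset.add_sum_erase _ _ hαpos, hsum, add_zero, coroot,
      inner_smul_right, div_mul_cancel₀ _ (inner_self_ne_zero.mpr hα0)]
  linarith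

/-- `u 0, …, u (n - 1)` are pairwise orthogonal vectors of square length `q` such that `Δ` consists
of `2 • u 0` and of the differences `u (k + 1) - u k`: the standard coordinates of type `Cₙ`. -/
structure IsTypeCCoordinates (Δ : Finset V) (n : ℕ) (u : ℕ → V) (q : ℝ) : Prop where
  pos : 0 < q
  inner : ∀ i < n, ∀ j < n, ⟪u i, u j⟫ = if i = j then q else 0
  long_mem : (2 : ℝ) • u 0 ∈ Δ
  short_mem : ∀ k, k + 1 < n → u (k + 1) - u k ∈ Δ
  eq_of_mem : ∀ α ∈ Δ, α = (2 : ℝ) • u 0 ∨ ∃ k, k + 1 < n ∧ α = u (k + 1) - u k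

lemma cartanC_rev_apply {n i j : ℕ} (hi : i < n) (hj : j < n) :
    cartanC n ⟨n - 1 - i, by omega⟩ ⟨n - 1 - j, by omega⟩ =
      if i = j then 2 else if i + 1 = j then (if i = 0 then -2 else -1)
      else if j + 1 = i then -1 else 0 := by
  simp only [cartanC, cartanB, Matrix.transpose_apply, Fin.mk.injEq]
  split_ifs <;> first | rfl | omega

/-- The coordinate vectors `a 0 / 2`, `a 0 / 2 + a 1`, `a 0 / 2 + a 1 + a 2`, … -/
noncomputable def typeCCoordinate (a : ℕ → V) : ℕ → V
  | 0 => (1 / 2 : ℝ) • a 0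
  | k + 1 => typeCCoordinate a k + a (k + 1)

lemma exists_isTypeCCoordinates {Φ Δ : Finset V} (hΦ : IsRootSystem Φ) (hΔ : IsBase Φ Δ) {n : ℕ}
    (hn : 1 ≤ n) (hM : MatchesCartan Δ (cartanC n)) :
    ∃ (u : ℕ → V) (q : ℝ), IsTypeCCoordinates Δ n u q := by
  obtain ⟨e, he⟩ := hM
  let a : ℕ → V := fun k => if h : k < n then (e.symm ⟨n - 1 - k, by omega⟩ : V) else 0
  have ha : ∀ k (h : k < n), a k = (e.symm ⟨n - 1 - k, by omega⟩ : V) := fun k h => dif_pos h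
  have hmem : ∀ k < n, a k ∈ Δ := fun k h => by rw [ha k h]; exact Subtype.prop _
  have hpos : ∀ k < n, 0 < ⟪a k, a k⟫ := fun k h =>
    real_inner_self_pos.mpr (hΦ.ne_zero (hΔ.1 (hmem k h)))
  have hC : ∀ i < n, ∀ j < n, 2 * ⟪a i, a j⟫ =
      (if i = j then 2 else if i + 1 = j then (if i = 0 then -2 else -1)
        else if j + 1 = i then -1 else 0) * ⟪a j, a j⟫ := by
    intro i hi j hj
    have h := he (e.symm ⟨n - 1 - i, by omega⟩) (e.symm ⟨n - 1 - j, by omega⟩)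
    rw [e.apply_symm_apply, e.apply_symm_apply, cartanC_rev_apply hi hj, ← ha i hi, ← ha j hj,
      div_eq_iff (hpos j hj).ne'] at h
    rw [h]
    push_cast
    rfl
  obtain ⟨q, hq⟩ : ∃ q, ⟪a 0, a 0⟫ = 4 * q := ⟨⟪a 0, a 0⟫ / 4, by ring⟩
  have hq0 : 0 < q := by
    have := hpos 0 (by omega)
    linarith
  have hnorm : ∀ k, k + 1 < n → ⟪a (k + 1), a (k + 1)⟫ = 2 * q := by
    intro k
    induction k with
    | zero =>
      intro hk
      have h1 := hC 0 (by omega) 1 hk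
      have h2 := hC 1 hk 0 (by omega)
      rw [real_inner_comm] at h2
      norm_num at h1 h2
      rw [real_inner_self_eq_norm_sq] at hq ⊢
      linarith
    | succ k ih =>
      intro hk
      have h0 := ih (by omega)
      have h1 := hC (k + 1) (by omega) (k + 1 + 1) hk
      have h2 := hC (k + 1 + 1) hk (k + 1) (by omega)
      rw [real_inner_comm] at h2
      simp at h1 h2
      rw [real_inner_self_eq_norm_sq] at h0 ⊢
      linarith
  let u := typeCCoordinate a
  have hu0 : u 0 = (1 / 2 : ℝ) • a 0 := rfl
  have hus : ∀ k, u (k + 1) = u k + a (k + 1) := fun k => rfl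
  have hua0 : ∀ k < n, ⟪u k, a 0⟫ = if k = 0 then 2 * q else 0 := by
    intro k
    induction k with
    | zero =>
      intro _
      rw [hu0, real_inner_smul_left, hq, if_pos rfl]
      ring
    | succ k ih =>
      intro hk
      have h1 := hC (k + 1) hk 0 (by omega)
      rw [hus, inner_add_left, ih (by omega)]
      rw [hq] at h1
      rcases k with _ | k
      · norm_num at h1 ⊢
        linarith
      · simp at h1 ⊢
        linarith
  have hua : ∀ k < n, ∀ j, j + 1 < n →
      ⟪u k, a (j + 1)⟫ = if k = j + 1 then q else if k = j then -q else 0 := by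
    intro k
    induction k with
    | zero =>
      intro _ j hj
      have h1 := hC 0 (by omega) (j + 1) hj
      rw [hnorm j hj] at h1
      rw [hu0, real_inner_smul_left]
      rcases j with _ | j
      · norm_num at h1 ⊢
        linarith
      · simp at h1 ⊢
        linarith
    | succ k ih =>
      intro hk j hj
      have h1 := hC (k + 1) hk (j + 1) hj
      rw [hnorm j hj] at h1
      rw [hus, inner_add_left, ih (by omega) j hj]
      have h2 : k + 1 ≠ 0 := by omega
      simp only [h2, if_false] at h1
      split_ifs at h1 ⊢ <;> first | omega | linarith
  have huu : ∀ i < n, ∀ j < n, ⟪u i, u j⟫ = if i = j then q else 0 := by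
    intro i hi j
    induction j with
    | zero =>
      intro _
      rw [hu0, real_inner_smul_right, hua0 i hi]
      split_ifs <;> ring
    | succ j ih =>
      intro hj
      rw [hus, inner_add_right, ih (by omega), hua i hi j hj]
      split_ifs <;> first | omega | ring
  have hlong : (2 : ℝ) • u 0 = a 0 := by rw [hu0, smul_smul]; norm_num
  have hshort : ∀ k, u (k + 1) - u k = a (k + 1) := fun k => by rw [hus, add_sub_cancel_left]
  refine ⟨u, q, hq0, huu, hlong ▸ hmem 0 (by omega), fun k hk => hshort k ▸ hmem _ hk, ?_⟩
  intro α hα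
  obtain ⟨k, hk, hak⟩ : ∃ k < n, α = a k := by
    refine ⟨n - 1 - (e ⟨α, hα⟩ : ℕ), by omega, ?_⟩
    have hlt := (e ⟨α, hα⟩).isLt
    have h1 : (⟨n - 1 - (n - 1 - (e ⟨α, hα⟩ : ℕ)), by omega⟩ : Fin n) = e ⟨α, hα⟩ :=
      Fin.ext (by simp only; omega)
    rw [ha _ (by omega), h1, e.symm_apply_apply]
  rcases k with _ | k
  · exact Or.inl (by rw [hak, hlong])
  · exact Or.inr ⟨k, hk, by rw [hak, hshort]⟩

/-- `x` is one of the vectors `± u k` with `k < n`. -/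
def IsSignedCoordinate (n : ℕ) (u : ℕ → V) (x : V) : Prop :=
  ∃ k < n, x = u k ∨ x = -u k

lemma IsSignedCoordinate.neg {W : Type*} [NormedAddCommGroup W] {n : ℕ} {u : ℕ → W} {x : W}
    (hx : IsSignedCoordinate n u x) :
    IsSignedCoordinate n u (-x) := by
  obtain ⟨k, hk, rfl | rfl⟩ := hx
  · exact ⟨k, hk, Or.inr rfl⟩
  · exact ⟨k, hk, Or.inl (neg_neg _)⟩

lemma rootReflection_neg (α β : V) : rootReflection α (-β) = -rootReflection α β := by
  simp only [rootReflection, inner_neg_left, mul_neg, neg_div, neg_smul]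
  abel

lemma rootReflection_add (α β γ : V) :
    rootReflection α (β + γ) = rootReflection α β + rootReflection α γ := by
  simp only [rootReflection, inner_add_left, mul_add, add_div]
  module

namespace IsTypeCCoordinates

variable {Δ : Finset V} {n : ℕ} {u : ℕ → V} {q : ℝ}

lemma inner_long (hu : IsTypeCCoordinates Δ n u q) {k : ℕ} (hk : k < n) :
    ⟪(2 : ℝ) • u k, (2 : ℝ) • u k⟫ = 4 * q := by
  rw [real_inner_smul_left, real_inner_smul_right, hu.inner k hk k hk, if_pos rfl]
  ring

lemma inner_sub (hu : IsTypeCCoordinates Δ n u q) {i j : ℕ} (hi : i < n) (hj : j < n)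
    (hij : i ≠ j) : ⟪u i - u j, u i - u j⟫ = 2 * q := by
  simp only [inner_sub_left, inner_sub_right, hu.inner i hi i hi, hu.inner i hi j hj,
    hu.inner j hj i hi, hu.inner j hj j hj, hij, hij.symm, if_true, if_false]
  ring

lemma inner_add (hu : IsTypeCCoordinates Δ n u q) {i j : ℕ} (hi : i < n) (hj : j < n)
    (hij : i ≠ j) : ⟪u i + u j, u i + u j⟫ = 2 * q := by
  simp only [inner_add_left, inner_add_right, hu.inner i hi i hi, hu.inner i hi j hj,
    hu.inner j hj i hi, hu.inner j hj j hj, hij, hij.symm, if_true, if_false]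
  ring

lemma rootReflection_long (hu : IsTypeCCoordinates Δ n u q) {i k : ℕ} (hi : i < n) (hk : k < n) :
    rootReflection ((2 : ℝ) • u i) (u k) = if k = i then -u k else u k := by
  have hq := hu.pos
  rw [rootReflection, hu.inner_long hi, real_inner_smul_right, hu.inner k hk i hi]
  split_ifs with h
  · subst h
    rw [smul_smul, show 2 * (2 * q) / (4 * q) * 2 = 2 by field_simp; norm_num]
    module
  · simp

lemma rootReflection_short (hu : IsTypeCCoordinates Δ n u q) {i j k : ℕ} (hi : i < n) (hj : j < n)
    (hij : i ≠ j) (hk : k < n) :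
    rootReflection (u i - u j) (u k) = if k = i then u j else if k = j then u i else u k := by
  have hq := hu.pos
  rw [rootReflection, hu.inner_sub hi hj hij, inner_sub_right, hu.inner k hk i hi,
    hu.inner k hk j hj]
  split_ifs with h1 h2 h2
  · omega
  · subst h1
    rw [sub_zero, div_self (by positivity)]
    module
  · subst h2
    rw [zero_sub, mul_neg, neg_div, div_self (by positivity)]
    module
  · simp

lemma isSignedCoordinate_rootReflection (hu : IsTypeCCoordinates Δ n u q) {α x : V} (hα : α ∈ Δ)
    (hx : IsSignedCoordinate n u x) : IsSignedCoordinate n u (rootReflection α x) := by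
  have key : ∀ k < n, IsSignedCoordinate n u (rootReflection α (u k)) := by
    intro k hk
    rcases hu.eq_of_mem α hα with rfl | ⟨i, hi, rfl⟩
    · rw [hu.rootReflection_long (by omega) hk]
      split_ifs
      · exact ⟨k, hk, Or.inr rfl⟩
      · exact ⟨k, hk, Or.inl rfl⟩
    · rw [hu.rootReflection_short hi (by omega) (by omega) hk]
      split_ifs
      · exact ⟨i, by omega, Or.inl rfl⟩
      · exact ⟨i + 1, hi, Or.inl rfl⟩
      · exact ⟨k, hk, Or.inl rfl⟩
  obtain ⟨k, hk, rfl | rfl⟩ := hx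
  · exact key k hk
  · rw [rootReflection_neg]
    exact (key k hk).neg

/-- Every root of type `Cₙ` is a sum of two signed coordinate vectors. -/
lemma exists_add_eq (hu : IsTypeCCoordinates Δ n u q) {Φ : Finset V} (hn : 1 ≤ n)
    (hΦ : IsRootSystem Φ) (hΔ : IsBase Φ Δ) {β : V} (hβ : β ∈ Φ) :
    ∃ x y, IsSignedCoordinate n u x ∧ IsSignedCoordinate n u y ∧ β = x + y := by
  refine hΔ.root_induction hΦ (P := fun β => ∃ x y, IsSignedCoordinate n u x ∧
    IsSignedCoordinate n u y ∧ β = x + y) ?_ ?_ ?_ hβ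
  · intro α hα
    rcases hu.eq_of_mem α hα with rfl | ⟨i, hi, rfl⟩
    · exact ⟨u 0, u 0, ⟨0, hn, Or.inl rfl⟩, ⟨0, hn, Or.inl rfl⟩, two_smul _ _⟩
    · exact ⟨u (i + 1), -u i, ⟨i + 1, hi, Or.inl rfl⟩, ⟨i, by omega, Or.inr rfl⟩,
        sub_eq_add_neg _ _⟩
  · rintro α hα β ⟨x, y, hx, hy, hxy⟩
    refine ⟨_, _, hu.isSignedCoordinate_rootReflection hα hx,
      hu.isSignedCoordinate_rootReflection hα hy, ?_⟩
    rw [← rootReflection_add, ← hxy, rootReflection_rootReflection α β (hΦ.ne_zero (hΔ.1 hα))]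
  · rintro β ⟨x, y, hx, hy, hxy⟩
    exact ⟨-x, -y, hx.neg, hy.neg, by rw [← neg_add, ← hxy, neg_neg]⟩

lemma long_mem_roots (hu : IsTypeCCoordinates Δ n u q) {Φ : Finset V}
    (hΦ : IsRootSystem Φ) (hΔ : IsBase Φ Δ) : ∀ k < n, (2 : ℝ) • u k ∈ Φ := by
  intro k
  induction k with
  | zero => exact fun _ => hΔ.1 hu.long_mem
  | succ k ih =>
    intro hk
    have h := hΦ.rootReflection_mem (hΔ.1 (hu.short_mem k hk)) (ih (by omega))
    rw [two_smul, rootReflection_add, hu.rootReflection_short hk (by omega) (by omega) (by omega),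
      if_neg (by omega), if_pos rfl, ← two_smul ℝ] at h
    exact h

lemma add_mem_roots (hu : IsTypeCCoordinates Δ n u q) {Φ : Finset V}
    (hΦ : IsRootSystem Φ) (hΔ : IsBase Φ Δ) {k : ℕ} (hk : k + 1 < n) : u (k + 1) + u k ∈ Φ := by
  have h := hΦ.rootReflection_mem (hu.long_mem_roots hΦ hΔ k (by omega))
    (hΔ.1 (hu.short_mem k hk))
  rwa [sub_eq_add_neg, rootReflection_add, rootReflection_neg,
    hu.rootReflection_long (by omega) hk, hu.rootReflection_long (by omega) (by omega),
    if_neg (by omega), if_pos rfl, neg_neg] at h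

lemma coroot_long (hu : IsTypeCCoordinates Δ n u q) {k : ℕ} (hk : k < n) :
    coroot ((2 : ℝ) • u k) = (1 / q) • u k := by
  have hq := hu.pos
  rw [coroot, hu.inner_long hk, smul_smul]
  congr 1
  field_simp
  norm_num

lemma coroot_add (hu : IsTypeCCoordinates Δ n u q) {i j : ℕ} (hi : i < n) (hj : j < n)
    (hij : i ≠ j) : coroot (u i + u j) = (1 / q) • u i + (1 / q) • u j := by
  have hq := hu.pos
  rw [coroot, hu.inner_add hi hj hij, ← smul_add]
  congr 1
  field_simp

lemma coroot_sub (hu : IsTypeCCoordinates Δ n u q) {i j : ℕ} (hi : i < n) (hj : j < n)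
    (hij : i ≠ j) : coroot (u i - u j) = (1 / q) • u i - (1 / q) • u j := by
  have hq := hu.pos
  rw [coroot, hu.inner_sub hi hj hij, ← smul_sub]
  congr 1
  field_simp

end IsTypeCCoordinates

lemma coroot_neg (β : V) : coroot (-β) = -coroot β := by
  simp [coroot]

namespace IsTypeCCoordinates

variable {Δ : Finset V} {n : ℕ} {u : ℕ → V} {q : ℝ}

/-- The coroots of type `Cₙ` lie in the lattice spanned by the rescaled coordinate vectors. -/
lemma coroot_mem_span (hu : IsTypeCCoordinates Δ n u q) {Φ : Finset V} (hn : 1 ≤ n)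
    (hΦ : IsRootSystem Φ) (hΔ : IsBase Φ Δ) {β : V} (hβ : β ∈ Φ) :
    coroot β ∈ Submodule.span ℤ ((fun k => (1 / q) • u k) '' Set.Iio n) := by
  have hv : ∀ k < n, (1 / q) • u k ∈ Submodule.span ℤ ((fun k => (1 / q) • u k) '' Set.Iio n) :=
    fun k hk => Submodule.subset_span ⟨k, hk, rfl⟩
  have hβ0 := hΦ.ne_zero hβ
  obtain ⟨x, y, ⟨i, hi, hx⟩, ⟨j, hj, hy⟩, rfl⟩ := hu.exists_add_eq hn hΦ hΔ hβ
  by_cases hij : i = j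
  · subst hij
    rcases hx with rfl | rfl <;> rcases hy with rfl | rfl
    · rw [← two_smul ℝ, hu.coroot_long hi]
      exact hv i hi
    · simp at hβ0
    · simp at hβ0
    · rw [← neg_add, coroot_neg, ← two_smul ℝ, hu.coroot_long hi]
      exact neg_mem (hv i hi)
  · rcases hx with rfl | rfl <;> rcases hy with rfl | rfl
    · rw [hu.coroot_add hi hj hij]
      exact add_mem (hv i hi) (hv j hj)
    · rw [← sub_eq_add_neg, hu.coroot_sub hi hj hij]
      exact sub_mem (hv i hi) (hv j hj)
    · rw [neg_add_eq_sub, hu.coroot_sub hj hi (Ne.symm hij)]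
      exact sub_mem (hv j hj) (hv i hi)
    · rw [← neg_add, coroot_neg, hu.coroot_add hi hj hij]
      exact neg_mem (add_mem (hv i hi) (hv j hj))

/-- The height of `u k` is `k + 1 / 2`. -/
lemma inner_half_sum (hu : IsTypeCCoordinates Δ n u q) {ρv : V} (hρ : ∀ α ∈ Δ, ⟪α, ρv⟫ = 1) :
    ∀ k < n, ⟪u k, ρv⟫ = k + 1 / 2 := by
  intro k
  induction k with
  | zero =>
    intro _
    have h := hρ _ hu.long_mem
    rw [real_inner_smul_left] at h
    push_cast
    linarith
  | succ k ih =>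
    intro hk
    have h := hρ _ (hu.short_mem k hk)
    rw [inner_sub_left, ih (by omega)] at h
    push_cast
    linarith

/-- The alternating sum of coordinates. -/
lemma inner_alternating_sum (hu : IsTypeCCoordinates Δ n u q) {k : ℕ} (hk : k < n) :
    ⟪u k, ∑ i ∈ Finset.range n, (-1 : ℝ) ^ i • u i⟫ = (-1) ^ k * q := by
  rw [inner_sum, Finset.sum_eq_single_of_mem k (Finset.mem_range.mpr hk)]
  · rw [real_inner_smul_right, hu.inner k hk k hk, if_pos rfl]
  · intro i hi hik
    rw [real_inner_smul_right, hu.inner k hk i (Finset.mem_range.mp hi), if_neg (Ne.symm hik),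
      mul_zero]

/-- The alternating sum of coordinates vanishes on the roots of even height. -/
lemma inner_alternating_sum_eq_zero (hu : IsTypeCCoordinates Δ n u q) {Φ : Finset V} (hn : 1 ≤ n)
    (hΦ : IsRootSystem Φ) (hΔ : IsBase Φ Δ) {ρv : V} (hρ : ∀ α ∈ Δ, ⟪α, ρv⟫ = 1) {β : V}
    (hβ : β ∈ Φ) {m : ℤ} (hm : ⟪β, ρv⟫ = 2 * (m : ℝ)) :
    ⟪β, ∑ i ∈ Finset.range n, (-1 : ℝ) ^ i • u i⟫ = 0 := by
  have key : ∀ x, IsSignedCoordinate n u x → ∃ a : ℤ, ⟪x, ρv⟫ = a + 1 / 2 ∧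
      ⟪x, ∑ i ∈ Finset.range n, (-1 : ℝ) ^ i • u i⟫ = (-1) ^ a * q := by
    rintro x ⟨k, hk, rfl | rfl⟩
    · exact ⟨k, by rw [hu.inner_half_sum hρ k hk]; norm_cast,
        by rw [hu.inner_alternating_sum hk, zpow_natCast]⟩
    · refine ⟨-k - 1, ?_, ?_⟩
      · rw [inner_neg_left, hu.inner_half_sum hρ k hk]
        push_cast
        ring
      · rw [inner_neg_left, hu.inner_alternating_sum hk, zpow_sub₀ (by norm_num), zpow_neg,
          zpow_natCast, ← inv_pow]
        norm_num
        ring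
  obtain ⟨x, y, hx, hy, rfl⟩ := hu.exists_add_eq hn hΦ hΔ hβ
  obtain ⟨a, hax, hax'⟩ := key x hx
  obtain ⟨b, hby, hby'⟩ := key y hy
  have hab : b = (2 * (m - a - 1)) + (a + 1) := by
    rw [inner_add_left, hax, hby] at hm
    have h : (a : ℝ) + b + 1 = 2 * m := by linarith
    have h' : a + b + 1 = 2 * m := by exact_mod_cast h
    omega
  rw [inner_add_left, hax', hby', hab, zpow_add₀ (by norm_num), zpow_add₀ (by norm_num),
    zpow_mul]
  norm_num

end IsTypeCCoordinates

lemma cartanA_one_eq_cartanC_one : cartanA 1 = cartanC 1 := by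
  ext i j
  fin_cases i
  fin_cases j
  rfl

theorem coweight_lattice_quotient_isomorphic_to_int_for_A1_Cn
    [FiniteDimensional ℝ V] (Φ Δ : Finset V)
    (hΦ : IsRootSystem Φ) (hirr : IsIrreducibleRS Φ) (hΔ : IsBase Φ Δ)
    -- `G` is of type A₁ or Cₙ
    (htype : MatchesCartan Δ (cartanA 1) ∨ ∃ n : ℕ, 1 ≤ n ∧ MatchesCartan Δ (cartanC n))
    -- ρ^∨, the half sum of the positive coroots
    (ρv : V) (Φpos : Finset V) (hpos : ∀ β, β ∈ Φpos ↔ β ∈ positiveRoots Φ Δ)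
    (hρ : (2 : ℝ) • ρv = ∑ β ∈ Φpos, coroot β)
    -- the subsystem Φ_K of roots pairing evenly with ρ^∨ (the roots of K = G^{ρ^∨(−1)})
    (ΦK : Finset V) (hΦK : ∀ β, β ∈ ΦK ↔ β ∈ Φ ∧ ∃ n : ℤ, ⟪β, ρv⟫ = 2 * (n : ℝ))
    -- the coweight lattice (= coroot lattice of simply connected G) and the coroot lattice of K
    (Λ ΛK : Submodule ℤ V)
    (hΛ : Λ = Submodule.span ℤ (coroot '' (Φ : Set V)))
    (hΛK : ΛK = Submodule.span ℤ (coroot '' (ΦK : Set V))) :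
    Nonempty ((↥Λ ⧸ ΛK.comap Λ.subtype) ≃ₗ[ℤ] ℤ) := by
  have hC : ∃ n : ℕ, 1 ≤ n ∧ MatchesCartan Δ (cartanC n) :=
    htype.elim (fun h => ⟨1, le_rfl, cartanA_one_eq_cartanC_one ▸ h⟩) id
  obtain ⟨n, hn, hM⟩ := hC
  obtain ⟨u, q, hu⟩ := exists_isTypeCCoordinates hΦ hΔ hn hM
  have hq := hu.pos
  have hheight : ∀ α ∈ Δ, ⟪α, ρv⟫ = 1 := fun α hα => hΔ.inner_half_sum_eq_one hΦ hpos hρ hα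
  have hadd : ∀ k, k + 1 < n → (1 / q) • u (k + 1) + (1 / q) • u k ∈ ΛK := by
    intro k hk
    rw [← hu.coroot_add hk (by omega) (by omega), hΛK]
    refine Submodule.subset_span ⟨_, (hΦK _).mpr ⟨hu.add_mem_roots hΦ hΔ hk, k + 1, ?_⟩, rfl⟩
    rw [inner_add_left, hu.inner_half_sum hheight _ hk, hu.inner_half_sum hheight k (by omega)]
    push_cast
    ring
  have hgen : ∀ x ∈ Λ, ∃ m : ℤ, m • ((1 / q) • u 0) - x ∈ ΛK := by
    have hcoord : ∀ k < n, ∃ m : ℤ, m • ((1 / q) • u 0) - (1 / q) • u k ∈ ΛK := by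
      intro k
      induction k with
      | zero => exact fun _ => ⟨1, by simp⟩
      | succ k ih =>
        intro hk
        obtain ⟨m, hm⟩ := ih (by omega)
        refine ⟨-m, ?_⟩
        convert neg_mem (add_mem hm (hadd k hk)) using 1
        module
    intro x hx
    have hx' : x ∈ Submodule.span ℤ ((fun k => (1 / q) • u k) '' Set.Iio n) := by
      rw [hΛ] at hx
      refine Submodule.span_le.mpr ?_ hx
      rintro _ ⟨β, hβ, rfl⟩
      exact hu.coroot_mem_span hn hΦ hΔ hβ
    clear hx
    induction hx' using Submodule.span_induction with
    | mem x h =>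
      obtain ⟨k, hk, rfl⟩ := h
      exact hcoord k hk
    | zero => exact ⟨0, by simp⟩
    | add x y _ _ ihx ihy =>
      obtain ⟨a, ha⟩ := ihx
      obtain ⟨b, hb⟩ := ihy
      exact ⟨a + b, by rw [add_smul, add_sub_add_comm]; exact add_mem ha hb⟩
    | smul c x _ ih =>
      obtain ⟨a, ha⟩ := ih
      exact ⟨c * a, by rw [mul_smul, ← smul_sub]; exact ΛK.smul_mem c ha⟩
  have hker : ∀ x ∈ ΛK, ⟪x, ∑ i ∈ Finset.range n, (-1 : ℝ) ^ i • u i⟫ = 0 := by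
    intro x hx
    rw [hΛK] at hx
    induction hx using Submodule.span_induction with
    | mem x h =>
      obtain ⟨β, hβ, rfl⟩ := h
      obtain ⟨hβΦ, m, hm⟩ := (hΦK β).mp hβ
      rw [coroot, real_inner_smul_left,
        hu.inner_alternating_sum_eq_zero hn hΦ hΔ hheight hβΦ hm, mul_zero]
    | zero => exact inner_zero_left _
    | add x y _ _ ihx ihy => rw [inner_add_left, ihx, ihy, add_zero]
    | smul a x _ ih => rw [← Int.cast_smul_eq_zsmul ℝ, real_inner_smul_left, ih, mul_zero]
  have hv0 : (1 / q) • u 0 ∈ Λ := by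
    rw [← hu.coroot_long hn, hΛ]
    exact Submodule.subset_span ⟨_, hΔ.1 hu.long_mem, rfl⟩
  let φ : ℤ →ₗ[ℤ] (↥Λ ⧸ ΛK.comap Λ.subtype) :=
    LinearMap.toSpanSingleton ℤ _ (Submodule.Quotient.mk ⟨_, hv0⟩)
  have hφ : ∀ m : ℤ, φ m = Submodule.Quotient.mk (m • ⟨_, hv0⟩) := fun m => rfl
  refine ⟨(LinearEquiv.ofBijective φ ⟨?_, ?_⟩).symm⟩
  · rw [injective_iff_map_eq_zero]
    intro m hm
    rw [hφ, Submodule.Quotient.mk_eq_zero] at hm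
    have h := hker _ hm
    rw [map_smul, Submodule.subtype_apply, ← Int.cast_smul_eq_zsmul ℝ, real_inner_smul_left,
      real_inner_smul_left, hu.inner_alternating_sum hn, pow_zero, one_mul,
      one_div_mul_cancel hq.ne', mul_one] at h
    exact_mod_cast h
  · intro y
    obtain ⟨x, rfl⟩ := Submodule.Quotient.mk_surjective _ y
    obtain ⟨m, hm⟩ := hgen x x.2
    exact ⟨m, by rw [hφ, Submodule.Quotient.eq]; exact hm⟩
end

section
/- Let g be a semisimple Lie algebra over an algebraically closed field of characteristic 0 with root system Φ and Cartan subalgebra t, and let τ be an involution of g normalizing t and inducing an involution on Φ. Then dim g^τ ≥ #Φ/2. -/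
section

open Module

lemma LinearMap.trace_eq_two_mul_finrank_ker_sub_id {K V : Type*} [Field K] [CharZero K]
    [AddCommGroup V] [Module K V] [FiniteDimensional K V] {f : V →ₗ[K] V}
    (hf : ∀ x, f (f x) = x) :
    LinearMap.trace K V f = 2 * finrank K (LinearMap.ker (f - LinearMap.id)) - finrank K V := by
  have hp : LinearMap.IsProj (LinearMap.ker (f - LinearMap.id))
      ((2⁻¹ : K) • (f + LinearMap.id)) := by
    constructor
    · intro x
      simp [hf, add_comm]
    · intro x hx
      have hx' : f x = x := by simpa [sub_eq_zero] using hx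
      rw [LinearMap.smul_apply, LinearMap.add_apply, hx', LinearMap.id_apply, ← two_smul K x,
        smul_smul]
      simp
  have h := hp.trace
  rw [map_smul, map_add, LinearMap.trace_id, smul_eq_mul] at h
  linear_combination 2 * h

/-- An involution permuting the summands of an internal direct sum has a fixed space whose
dimension is half that of the permuted summands plus that of the fixed vectors in the
preserved summands. -/
lemma DirectSum.IsInternal.two_mul_finrank_ker_sub_id {K V ι : Type*} [Field K] [CharZero K]
    [AddCommGroup V] [Module K V] [FiniteDimensional K V] [Fintype ι] [DecidableEq ι]
    {N : ι → Submodule K V} (h : DirectSum.IsInternal N) {f : V →ₗ[K] V}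
    (hf : ∀ x, f (f x) = x) {σ : ι → ι} (hσ : ∀ i, ∀ x ∈ N i, f x ∈ N (σ i)) :
    2 * finrank K (LinearMap.ker (f - LinearMap.id)) =
      ∑ i, if σ i = i then 2 * finrank K ↥(N i ⊓ LinearMap.ker (f - LinearMap.id))
        else finrank K (N i) := by
  classical
  let e := LinearEquiv.ofBijective (DirectSum.coeLinearMap N) h
  have he (j : ι) (x : N j) : e.symm x = DirectSum.lof K ι (fun i ↦ N i) j x := by
    rw [LinearEquiv.symm_apply_eq]
    exact (DirectSum.coeLinearMap_lof N j x).symm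
  let C (i : ι) : V →ₗ[K] N i := DirectSum.component K ι (fun i ↦ N i) i ∘ₗ e.symm.toLinearMap
  have hC (i : ι) (x : N i) : C i x = x := by simp [C, he, DirectSum.component.lof_self]
  have hC' (i j : ι) (hij : j ≠ i) (x : V) (hx : x ∈ N j) : C i x = 0 := by
    have := he j ⟨x, hx⟩
    simp only at this
    simp [C, this, DirectSum.component.of, hij]
  have hsum (x : V) : ∑ i, (C i x : V) = x := by
    obtain ⟨y, rfl⟩ := e.surjective x
    simp only [LinearMap.comp_apply, C, LinearEquiv.coe_coe, e.symm_apply_apply]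
    exact (DFinsupp.sum_eq_sum_fintype _ (by simp)).symm.trans
      (DirectSum.coeLinearMap_eq_dfinsuppSum N y).symm
  have htr : LinearMap.trace K V f =
      ∑ i, LinearMap.trace K (N i) (C i ∘ₗ f ∘ₗ (N i).subtype) := by
    have : f = ∑ i, (N i).subtype ∘ₗ C i ∘ₗ f := by
      ext x
      simp [hsum]
    conv_lhs => rw [this, map_sum]
    refine Finset.sum_congr rfl fun i _ ↦ ?_
    rw [LinearMap.trace_comp_comm', LinearMap.comp_assoc]
  have hterm (i : ι) : LinearMap.trace K (N i) (C i ∘ₗ f ∘ₗ (N i).subtype) + finrank K (N i) =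
      ((if σ i = i then 2 * finrank K ↥(N i ⊓ LinearMap.ker (f - LinearMap.id))
        else finrank K (N i) : ℕ) : K) := by
    split_ifs with hi
    · have hfi (x : N i) : f x ∈ N i := by simpa only [hi] using hσ i x x.2
      have hfi' (x : N i) : (C i ∘ₗ f ∘ₗ (N i).subtype) x = ⟨f x, hfi x⟩ := hC i ⟨f x, hfi x⟩
      rw [LinearMap.trace_eq_two_mul_finrank_ker_sub_id (fun x ↦ by simp [hfi', hf])]
      have : (LinearMap.ker (C i ∘ₗ f ∘ₗ (N i).subtype - LinearMap.id)).map (N i).subtype =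
          N i ⊓ LinearMap.ker (f - LinearMap.id) := by
        ext x
        constructor
        · rintro ⟨y, hy, rfl⟩
          refine ⟨y.2, ?_⟩
          rw [SetLike.mem_coe, LinearMap.mem_ker, LinearMap.sub_apply, hfi', sub_eq_zero] at hy
          simpa [sub_eq_zero] using congr_arg Subtype.val hy
        · rintro ⟨hx, hx'⟩
          refine ⟨⟨x, hx⟩, ?_, rfl⟩
          rw [SetLike.mem_coe, LinearMap.mem_ker, LinearMap.sub_apply, hfi', sub_eq_zero]
          exact Subtype.ext (by simpa [sub_eq_zero] using hx')
      rw [← this, LinearEquiv.finrank_eq (Submodule.equivMapOfInjective _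
        (N i).injective_subtype _).symm]
      push_cast
      ring
    · have : C i ∘ₗ f ∘ₗ (N i).subtype = 0 := by
        ext x
        simp [hC' i (σ i) hi _ (hσ i x x.2)]
      simp [this]
  have hdim : finrank K V = ∑ i, finrank K (N i) := by
    rw [e.symm.finrank_eq, Module.finrank_directSum]
  rw [← Nat.cast_inj (R := K), Nat.cast_sum, ← Finset.sum_congr rfl fun i _ ↦ hterm i,
    Finset.sum_add_distrib, ← htr, LinearMap.trace_eq_two_mul_finrank_ker_sub_id hf, hdim]
  push_cast
  ring

namespace RootPairing

variable {ι R M N : Type*} [Field R] [CharZero R] [AddCommGroup M] [Module R M]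
  [AddCommGroup N] [Module R N] (P : RootPairing ι R M N)

lemma card_le_two_mul_finrank_of_pairwise_orthogonal [FiniteDimensional R N]
    (W : Submodule R N) (S : Finset ι)
    (hW : ∀ i ∈ S, P.coroot i ∈ W)
    (hS : ∀ i ∈ S, ∀ j ∈ S, j = i ∨ j = P.reflectionPerm i i ∨ P.pairing i j = 0) :
    S.card ≤ 2 * finrank R W := by
  classical
  induction hn : S.card using Nat.strong_induction_on generalizing S W with
  | _ n ih =>
  subst hn
  rcases S.eq_empty_or_nonempty with rfl | ⟨i, hi⟩
  · simp
  let T := (S.erase i).erase (P.reflectionPerm i i)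
  have hTS : T ⊆ S := (Finset.erase_subset _ _).trans (Finset.erase_subset _ _)
  have hT : S.card ≤ T.card + 2 := by
    have h₁ := Finset.card_erase_add_one hi
    have h₂ := Finset.pred_card_le_card_erase (s := S.erase i) (a := P.reflectionPerm i i)
    simp only [T]
    lia
  have hlt : W ⊓ LinearMap.ker (P.root' i) < W := by
    refine inf_le_left.lt_of_ne fun h ↦ ?_
    have hi' := hW i hi
    rw [← h] at hi'
    simpa using hi'.2
  have := ih T.card (Finset.card_lt_card ⟨hTS, fun h ↦ by simpa [T] using h hi⟩)
    (W ⊓ LinearMap.ker (P.root' i)) T (fun j hj ↦ ⟨hW j (hTS hj), ?_⟩)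
    (fun j hj k hk ↦ hS j (hTS hj) k (hTS hk)) rfl
  · have := Submodule.finrank_lt_finrank_of_lt hlt
    lia
  · simp only [T, Finset.mem_erase] at hj
    have := hS i hi j hj.2.2
    simpa [hj.1, hj.2.1] using this

variable [Finite ι] [P.IsCrystallographic] [P.IsReduced]

lemma pairing_eq_zero_of_even {i j : ι} (h : Even (P.pairingIn ℤ i j))
    (h' : Even (P.pairingIn ℤ j i)) :
    j = i ∨ j = P.reflectionPerm i i ∨ P.pairing i j = 0 := by
  have := P.pairingIn_pairingIn_mem_set_of_isCrystal_of_isRed i j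
  simp only [Set.mem_insert_iff, Set.mem_singleton_iff, Prod.mk.injEq] at this
  have h0 : (P.pairingIn ℤ i j = 0 ∧ P.pairingIn ℤ j i = 0) ∨
    (P.pairingIn ℤ i j = 2 ∧ P.pairingIn ℤ j i = 2) ∨
    (P.pairingIn ℤ i j = -2 ∧ P.pairingIn ℤ j i = -2) := by
    obtain ⟨a, ha⟩ := h
    obtain ⟨b, hb⟩ := h'
    omega
  rcases h0 with h0 | h0 | h0
  · right; right
    rw [← P.algebraMap_pairingIn ℤ, h0.1, map_zero]
  · left
    exact ((P.pairingIn_two_two_iff ℤ i j).mp h0).symm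
  · right; left
    have := (P.pairingIn_neg_two_neg_two_iff ℤ i j).mp h0
    apply P.root.injective
    rw [root_reflectionPerm, reflection_apply_self, this, neg_neg]

/-- Let `s` be a sign function on a set `S` of roots, such that `S` is stable under reflection in
its negative roots and reflecting in a negative root flips the sign of roots having odd pairing
with it. The excess of negative roots over positive ones is at most twice the dimension of a space
containing the negative coroots. -/
lemma neg_sum_sign_le_two_mul_finrank [FiniteDimensional R N] (s : ι → ℤ)
    (hs : ∀ i, s i = 1 ∨ s i = -1)
    (W : Submodule R N) (S : Finset ι) (hW : ∀ i ∈ S, P.coroot i ∈ W)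
    (hS : ∀ i ∈ S, ∀ j ∈ S, P.reflectionPerm i j ∈ S)
    (hodd : ∀ i ∈ S, ∀ j ∈ S, s i = -1 → Odd (P.pairingIn ℤ j i) →
      s (P.reflectionPerm i j) = -s j) :
    -∑ i ∈ S, s i ≤ 2 * finrank R W := by
  classical
  induction hn : S.card using Nat.strong_induction_on generalizing S with
  | _ n ih =>
  subst hn
  by_cases hex : ∃ i ∈ S, s i = -1 ∧ ∃ j ∈ S, Odd (P.pairingIn ℤ j i)
  · obtain ⟨i, hi, hsi, j, hj, hij⟩ := hex
    have hpair (k l : ι) : P.pairingIn ℤ (P.reflectionPerm k l) i =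
        P.pairingIn ℤ l i - P.pairingIn ℤ l k * P.pairingIn ℤ k i := by
      rw [← Int.cast_inj (α := R)]
      have (a b : ι) : (P.pairingIn ℤ a b : R) = P.pairing a b := P.algebraMap_pairingIn ℤ a b
      push_cast
      simp only [this]
      rw [← P.root_coroot_eq_pairing, root_reflectionPerm, reflection_apply_root]
      simp
    have hbal : ∑ j ∈ S with ¬ Even (P.pairingIn ℤ j i), s j = 0 := by
      refine Finset.sum_involution (fun j _ ↦ P.reflectionPerm i j) ?_ ?_ ?_ ?_
      · intro k hk
        rw [Finset.mem_filter, Int.not_even_iff_odd] at hk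
        rw [hodd i hi k hk.1 hsi hk.2]
        ring
      · intro k hk hk0 hk'
        rw [Finset.mem_filter, Int.not_even_iff_odd] at hk
        have := hodd i hi k hk.1 hsi hk.2
        rw [hk'] at this
        lia
      · intro k hk
        rw [Finset.mem_filter] at hk ⊢
        refine ⟨hS i hi k hk.1, ?_⟩
        rw [hpair, P.pairingIn_same ℤ]
        grind
      · simp
    rw [← Finset.sum_filter_add_sum_filter_not S (fun j ↦ Even (P.pairingIn ℤ j i)), hbal,
      add_zero]
    refine ih _ (Finset.card_lt_card ⟨Finset.filter_subset _ _, fun h ↦ ?_⟩) _ ?_ ?_ ?_ rfl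
    · have := h hj
      rw [Finset.mem_filter] at this
      exact Int.not_even_iff_odd.mpr hij this.2
    · exact fun k hk ↦ hW k (Finset.filter_subset _ _ hk)
    · intro k hk l hl
      rw [Finset.mem_filter] at hk hl ⊢
      refine ⟨hS k hk.1 l hl.1, ?_⟩
      rw [hpair]
      exact hl.2.sub (hk.2.mul_left _)
    · exact fun k hk l hl ↦ hodd k (Finset.filter_subset _ _ hk) l (Finset.filter_subset _ _ hl)
  · push Not at hex
    have hcard : -∑ i ∈ S, s i ≤ (S.filter (s · = -1)).card := by
      rw [← Finset.sum_neg_distrib, Finset.card_filter, Nat.cast_sum]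
      refine Finset.sum_le_sum fun i _ ↦ ?_
      rcases hs i with h | h <;> simp [h]
    refine hcard.trans ?_
    have := P.card_le_two_mul_finrank_of_pairwise_orthogonal W (S.filter (s · = -1))
      (fun i hi ↦ hW i (Finset.filter_subset _ _ hi)) (fun i hi j hj ↦ ?_)
    · exact_mod_cast this
    · rw [Finset.mem_filter] at hi hj
      exact P.pairing_eq_zero_of_even (Int.not_odd_iff_even.mp (hex j hj.1 hj.2 i hi.1))
        (Int.not_odd_iff_even.mp (hex i hi.1 hi.2 j hj.1))

end RootPairing

namespace LieAlgebra.IsKilling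

open LieModule

variable {K g : Type*} [Field K] [CharZero K] [LieRing g] [LieAlgebra K g] [FiniteDimensional K g]
  [IsKilling K g] {H : LieSubalgebra K g} [H.IsCartanSubalgebra] [IsTriangularizable K H g]
  {τ : g ≃ₗ⁅K⁆ g} (hinv : ∀ x : g, τ (τ x) = x) (hH : ∀ x ∈ H, τ x ∈ H)

include hinv in
lemma map_mem_rootSpace {χ ψ : H → K} (hψ : ∀ h : H, ψ h = χ ⟨τ h, hH h h.2⟩) {x : g}
    (hx : x ∈ rootSpace H χ) : τ x ∈ rootSpace H ψ := by
  refine weightSpace_le_genWeightSpace g ψ ((mem_weightSpace ψ _).mpr fun h ↦ ?_)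
  have := lie_eq_smul_of_mem_rootSpace hx ⟨τ h, hH h h.2⟩
  rw [hψ, ← map_smul, ← this, LieSubalgebra.coe_bracket_of_module,
    LieSubalgebra.coe_bracket_of_module, LieEquiv.map_lie, hinv]

include hinv in
/-- An involution acts by a sign on the root space of a root which it fixes. -/
lemma exists_sign_forall_mem_rootSpace {α : Weight K H g} (hα : α.IsNonZero)
    (hfix : ∀ h : H, α h = α ⟨τ h, hH h h.2⟩) :
    ∃ c : ℤ, (c = 1 ∨ c = -1) ∧ ∀ x ∈ rootSpace H α, τ x = (c : K) • x := by
  obtain ⟨v, hv, hv0⟩ := α.exists_ne_zero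
  have hspan (x : g) (hx : x ∈ rootSpace H α) : ∃ k : K, k • v = x := by
    simpa using (finrank_eq_one_iff_of_nonzero' (⟨v, hv⟩ : rootSpace H α) (by simpa using hv0)).mp
      (finrank_rootSpace_eq_one α hα) ⟨x, hx⟩
  obtain ⟨k, hk⟩ := hspan _ (map_mem_rootSpace hinv hH hfix hv)
  have hkk : k * k = 1 := by
    have := hinv v
    rw [← hk, map_smul, ← hk, smul_smul] at this
    exact smul_left_injective K hv0 (this.trans (one_smul K v).symm)
  have key (c : ℤ) (hc : (c : K) = k) (x : g) (hx : x ∈ rootSpace H α) : τ x = (c : K) • x := by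
    obtain ⟨a, rfl⟩ := hspan x hx
    rw [map_smul, ← hk, hc, smul_comm]
  rcases mul_self_eq_one_iff.mp hkk with h | h
  · exact ⟨1, .inl rfl, key 1 (by simp [h])⟩
  · exact ⟨-1, .inr rfl, key (-1) (by simp [h])⟩

include hinv in
lemma map_coroot_eq_and_forall_mem_rootSpace_neg {α : Weight K H g} (hα : α.IsNonZero)
    (hfix : ∀ h : H, α h = α ⟨τ h, hH h h.2⟩) {c : ℤ} (hc : c = 1 ∨ c = -1)
    (hcα : ∀ x ∈ rootSpace H α, τ x = (c : K) • x) :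
    τ (coroot α : g) = coroot α ∧ ∀ x ∈ rootSpace H (-α), τ x = (c : K) • x := by
  obtain ⟨h, e, f, ht, he, hf⟩ := exists_isSl2Triple_of_weight_isNonZero hα
  obtain rfl := ht.h_eq_coroot hα he hf
  obtain ⟨d, hd, hdα⟩ := exists_sign_forall_mem_rootSpace hinv hH (α := -α) hα.neg
    (fun h ↦ by simp [hfix h])
  rw [Weight.coe_neg] at hdα
  have hτ : τ (coroot α : g) = ((c * d : ℤ) : K) • (coroot α : g) := by
    rw [← ht.lie_e_f, LieEquiv.map_lie, hcα e he, hdα f hf, smul_lie, lie_smul, smul_smul]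
    push_cast
    rfl
  have hcd : ((c * d : ℤ) : K) = 1 := by
    have h1 := hfix (coroot α)
    have : (⟨τ (coroot α : g), hH _ (coroot α).2⟩ : H) = ((c * d : ℤ) : K) • coroot α :=
      Subtype.ext hτ
    rw [this, ← Weight.toLinear_apply, ← Weight.toLinear_apply, map_smul, Weight.toLinear_apply,
      root_apply_coroot hα, smul_eq_mul] at h1
    exact mul_right_cancel₀ two_ne_zero (h1.symm.trans (one_mul _).symm)
  refine ⟨by rw [hτ, hcd, one_smul], ?_⟩
  rw [Int.cast_eq_one] at hcd
  obtain rfl : d = c := by rcases hc with rfl | rfl <;> rcases hd with rfl | rfl <;> simp_all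
  exact hdα

include hinv in
/-- Let `α` be a root fixed by an involution acting as `-1` on its root space. The involution acts
by opposite signs on the root spaces of `β` and of its reflection in `α` if `β` pairs oddly
with `α`. -/
lemma sign_eq_neg_of_odd {α β γ : Weight K H g} (hα : α.IsNonZero)
    (hfα : ∀ h : H, α h = α ⟨τ h, hH h h.2⟩) (hfβ : ∀ h : H, β h = β ⟨τ h, hH h h.2⟩)
    (hγ : ∀ h : H, γ h = β h - β (coroot α) * α h) {m : ℤ} (hm : β (coroot α) = m) (hodd : Odd m)
    (hcα : ∀ x ∈ rootSpace H α, τ x = -x) {b c : ℤ}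
    (hbβ : ∀ x ∈ rootSpace H β, τ x = (b : K) • x)
    (hcγ : ∀ x ∈ rootSpace H γ, τ x = (c : K) • x) :
    c = -b := by
  have hneg : ∀ x ∈ rootSpace H (-α), τ x = -x := by
    simpa using (map_coroot_eq_and_forall_mem_rootSpace_neg hinv hH hα hfα (c := -1) (.inr rfl)
      (by simpa using hcα)).2
  obtain ⟨h, e, f, ht, he, hf⟩ := exists_isSl2Triple_of_weight_isNonZero hα
  obtain rfl := ht.h_eq_coroot hα he hf
  obtain ⟨v, hv, hv0⟩ := (chainTop α β).exists_ne_zero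
  have prim : ht.HasPrimitiveVectorWith v (chainLength α β : K) :=
    have := lie_mem_genWeightSpace_of_mem_genWeightSpace he hv
    ⟨hv0, (chainLength_smul _ _ hv).symm, by rwa [genWeightSpace_add_chainTop _ _ hα] at this⟩
  have hp := chainTopCoeff_le_chainLength α β
  have hN := apply_coroot_eq_cast' α β
  obtain ⟨d, -, hd⟩ := exists_sign_forall_mem_rootSpace hinv hH (chainTop_isNonZero α β hα)
    (fun h ↦ by simp [← hfα h, ← hfβ h])
  have hpow (n : ℕ) : τ ((toEnd K g g f ^ n) v) = ((-1) ^ n * d : K) • (toEnd K g g f ^ n) v := by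
    induction n with
    | zero => simpa using hd v hv
    | succ n ih =>
      rw [pow_succ', Module.End.mul_apply, toEnd_apply_apply, LieEquiv.map_lie, ih, hneg f hf,
        neg_lie, lie_smul, pow_succ]
      simp
  have hsign (χ : Weight K H g) (n : ℕ) (hn : n ≤ chainLength α β) (a : ℤ)
      (hχ : (χ : H → K) = n • (-(α : H → K)) + chainTop α β)
      (ha : ∀ x ∈ rootSpace H χ, τ x = (a : K) • x) : a = (-1) ^ n * d := by
    have h1 := ha _ (hχ ▸ toEnd_pow_apply_mem hf hv n)
    rw [hpow] at h1
    have := smul_left_injective K (prim.pow_toEnd_f_ne_zero_of_eq_nat rfl hn) h1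
    exact_mod_cast this.symm
  have h1 := hsign β (chainTopCoeff α β) hp b (by ext h; simp) hbβ
  have h2 := hsign γ (chainLength α β - chainTopCoeff α β) (Nat.sub_le _ _) c
    (by ext h; simp [hγ, hN, Nat.cast_sub hp]; ring) hcγ
  have hm' : m = chainLength α β - 2 * chainTopCoeff α β := by
    rw [hm] at hN
    exact_mod_cast hN
  rcases Nat.even_or_odd (chainTopCoeff α β) with hpe | hpo
  · have : Odd (chainLength α β - chainTopCoeff α β) := by grind
    rw [h1, h2, this.neg_one_pow, hpe.neg_one_pow]
    ring
  · have : Even (chainLength α β - chainTopCoeff α β) := by grind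
    rw [h1, h2, this.neg_one_pow, hpo.neg_one_pow]
    ring

include hinv in
lemma exists_involution_weight :
    ∃ σ : Weight K H g → Weight K H g, (∀ χ (h : H), σ χ h = χ ⟨τ h, hH h h.2⟩) ∧
      ∀ (χ : Weight K H g), ∀ x ∈ rootSpace H χ, τ x ∈ rootSpace H (σ χ) := by
  have hmem (χ : Weight K H g) (x : g) (hx : x ∈ rootSpace H χ) :
      τ x ∈ rootSpace H fun h ↦ χ ⟨τ h, hH h h.2⟩ := map_mem_rootSpace hinv hH (fun _ ↦ rfl) hx
  refine ⟨fun χ ↦ ⟨fun h ↦ χ ⟨τ h, hH h h.2⟩, fun h ↦ ?_⟩, fun _ _ ↦ rfl, hmem⟩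
  obtain ⟨x, hx, hx0⟩ := χ.exists_ne_zero
  exact hx0 (by simpa [h] using hmem χ x hx)

include hinv hH in
lemma card_weight_isNonZero_le :
    Nat.card {w : Weight K H g // w.IsNonZero} ≤
      2 * finrank K (LinearMap.ker (τ.toLinearEquiv.toLinearMap - LinearMap.id)) := by
  classical
  cases subsingleton_or_nontrivial g
  · simp
  set F := LinearMap.ker (τ.toLinearEquiv.toLinearMap - LinearMap.id) with hF
  have hFmem (x : g) : x ∈ F ↔ τ x = x := by simp [hF, sub_eq_zero]
  obtain ⟨σ, hσ, hσmem⟩ := exists_involution_weight hinv hH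
  have hfix {χ : Weight K H g} (h : σ χ = χ) (x : H) : χ x = χ ⟨τ x, hH x x.2⟩ := by
    rw [← hσ, h]
  have hfix' {χ : Weight K H g} (h : ∀ x : H, χ x = χ ⟨τ x, hH x x.2⟩) : σ χ = χ :=
    Weight.ext fun x ↦ by rw [hσ, ← h]
  have hs (χ : Weight K H g) : ∃ c : ℤ, (c = 1 ∨ c = -1) ∧
      (χ.IsNonZero → σ χ = χ → ∀ x ∈ rootSpace H χ, τ x = (c : K) • x) := by
    by_cases hχ : χ.IsNonZero ∧ σ χ = χ
    · obtain ⟨c, hc, hc'⟩ := exists_sign_forall_mem_rootSpace hinv hH hχ.1 (hfix hχ.2)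
      exact ⟨c, hc, fun _ _ ↦ hc'⟩
    · exact ⟨1, .inl rfl, fun h h' ↦ absurd ⟨h, h'⟩ hχ⟩
  choose s hs hsmem using hs
  have hcoroot (α : Weight K H g) (hα : α.IsNonZero) (h : σ α = α) :
      τ (coroot α : g) = coroot α :=
    (map_coroot_eq_and_forall_mem_rootSpace_neg hinv hH hα (hfix h) (hs α)
      (hsmem α hα h)).1
  have hint : DirectSum.IsInternal fun χ : Weight K H g ↦ (rootSpace H χ).toSubmodule :=
    DirectSum.isInternal_submodule_of_iSupIndep_of_iSup_eq_top
      (LieSubmodule.iSupIndep_toSubmodule.mpr (iSupIndep_genWeightSpace' K H g))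
      (by rw [← LieSubmodule.iSup_toSubmodule, iSup_genWeightSpace_eq_top' K H g]; rfl)
  have hdim := hint.two_mul_finrank_ker_sub_id (f := τ.toLinearEquiv.toLinearMap) hinv hσmem
  rw [← hF] at hdim
  let W : Submodule K H := F.comap H.toSubmodule.subtype
  have hmain : -∑ α : H.root with σ α.1 = α.1, s α.1 ≤ 2 * finrank K W := by
    have hroot (α : H.root) : α.1.IsNonZero := (Finset.mem_filter.mp α.2).2
    have hrefl (α β : H.root) (x : H) : ((rootSystem H).reflectionPerm α β).1 x =
        β.1 x - β.1 (coroot α.1) * α.1 x := by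
      have := LinearMap.congr_fun ((rootSystem H).root_reflectionPerm α β) x
      rw [RootPairing.reflection_apply_root] at this
      exact this
    refine (rootSystem H).neg_sum_sign_le_two_mul_finrank (fun α ↦ s α.1)
      (fun α ↦ hs α.1) W _ (fun α hα ↦ ?_) (fun α hα β hβ ↦ ?_) (fun α hα β hβ hsα hodd ↦ ?_)
    · rw [Finset.mem_filter] at hα
      exact (hFmem _).mpr (hcoroot α.1 (hroot α) hα.2)
    · rw [Finset.mem_filter] at hα hβ ⊢
      refine ⟨Finset.mem_univ _, hfix' fun x ↦ ?_⟩
      rw [hrefl, hrefl, ← hfix hα.2, ← hfix hβ.2]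
    · rw [Finset.mem_filter] at hα hβ
      have hγ : σ ((rootSystem H).reflectionPerm α β).1 = ((rootSystem H).reflectionPerm α β).1 :=
        hfix' fun x ↦ by rw [hrefl, hrefl, ← hfix hα.2, ← hfix hβ.2]
      exact sign_eq_neg_of_odd hinv hH (hroot α) (hfix hα.2) (hfix hβ.2) (hrefl α β)
        ((rootSystem H).algebraMap_pairingIn ℤ β α).symm hodd
        (by simpa [hsα] using hsmem α.1 (hroot α) hα.2) (hsmem β.1 (hroot β) hβ.2)
        (hsmem _ (hroot _) hγ)
  have hterm (χ : Weight K H g) (hχ : χ.IsNonZero) :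
      ((if σ χ = χ then 2 * finrank K ↥((rootSpace H χ).toSubmodule ⊓ F)
        else finrank K (rootSpace H χ).toSubmodule : ℕ) : ℤ) =
      1 + if σ χ = χ then s χ else 0 := by
    have h1 : finrank K (rootSpace H χ).toSubmodule = 1 := finrank_rootSpace_eq_one χ hχ
    split_ifs with hfχ
    · have hsχ := hsmem χ hχ hfχ
      rcases hs χ with h | h <;> rw [h] at hsχ ⊢
      · rw [inf_eq_left.mpr fun x hx ↦ (hFmem x).mpr (by simpa using hsχ x hx), h1]
        norm_num
      · have : (rootSpace H χ).toSubmodule ⊓ F = ⊥ := by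
          refine (Submodule.eq_bot_iff _).mpr fun x ⟨hx, hx'⟩ ↦ ?_
          have h2 : -x = x := by simpa [(hFmem x).mp hx'] using (hsχ x hx).symm
          have : IsAddTorsionFree g := .of_isTorsionFree K g
          exact self_eq_neg.mp h2.symm
        simp [this]
    · simp [h1]
  have hzero : finrank K ↥((rootSpace H (0 : Weight K H g)).toSubmodule ⊓ F) = finrank K W := by
    have : (rootSpace H (0 : Weight K H g)).toSubmodule ⊓ F = W.map H.toSubmodule.subtype := by
      rw [Submodule.map_comap_subtype]
      congr 1
      ext x
      simp [rootSpace_zero_eq]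
    rw [this]
    exact (Submodule.equivMapOfInjective _ H.toSubmodule.injective_subtype W).symm.finrank_eq
  have hcard : Nat.card {w : Weight K H g // w.IsNonZero} = H.root.card := by
    rw [Nat.card_eq_fintype_card, Fintype.card_subtype]
  have hroot : Finset.univ.erase (0 : Weight K H g) = H.root := by
    ext χ
    simp [Weight.isNonZero_iff_ne_zero]
  have hσ0 : σ 0 = 0 := hfix' (by simp)
  rw [← Finset.add_sum_erase _ _ (Finset.mem_univ (0 : Weight K H g)), if_pos hσ0, hzero,
    hroot] at hdim
  have hsum := Finset.sum_congr rfl fun χ (hχ : χ ∈ H.root) ↦ hterm χ (by simpa using hχ)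
  rw [← Nat.cast_sum, Finset.sum_add_distrib, Finset.sum_const, ← Finset.sum_coe_sort H.root
    (fun χ ↦ if σ χ = χ then s χ else 0), ← Finset.sum_filter] at hsum
  rw [hcard]
  simp only [nsmul_eq_mul, mul_one] at hsum
  omega

end LieAlgebra.IsKilling

end

/-! STATEMENT 7: Let `g` be a semisimple Lie algebra over an algebraically closed field of
characteristic 0, with Cartan subalgebra `t = H` and root system `Φ` (the nonzero weights
of the adjoint action of `H`), and let `τ` be an involution of `g` normalizing `H` (hence
inducing an involution on `Φ`).  Then `dim g^τ ≥ #Φ / 2`. -/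

theorem dim_fixed_subalgebra_of_involution_ge_half_card_roots
    {K : Type*} [Field K] [IsAlgClosed K] [CharZero K]
    {g : Type*} [LieRing g] [LieAlgebra K g] [FiniteDimensional K g]
    [LieAlgebra.IsSemisimple K g]
    (H : LieSubalgebra K g) [H.IsCartanSubalgebra]
    (τ : g ≃ₗ⁅K⁆ g) (hinv : ∀ x : g, τ (τ x) = x)
    (hH : ∀ x ∈ H, τ x ∈ H) :
    Nat.card {w : LieModule.Weight K H g // w.IsNonZero} ≤
      2 * Module.finrank K
        ↥(LinearMap.ker (τ.toLinearEquiv.toLinearMap - LinearMap.id)) := by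
  exact LieAlgebra.IsKilling.card_weight_isNonZero_le hinv hH
end
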